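/- arXiv:2312.14908 — 2 statements merged into one kernel-verified Lean document; each statement's English description precedes it below -/
import Mathlib

section
/- For every m ≥ 1 and every 1 ≤ i ≤ m, the order-preserving maps [1]^{m−1} → [m] given by α_m ∘ δ_{i|1} and by δ_0^i ∘ υ_0^{i−1} ∘ α_{m−1} coincide, where δ_0^i: [m−i] → [m] is the i-fold composite of 0-th cofaces (j ↦ j + i) and υ_0^{i−1}: [m−1] → [m−i] is the (i−1)-fold composite of 0-th codegeneracies (j ↦ max(j−i+1, 0)). Equivalently, α_m(δ_{i|1}(r)) = max(α_{m−1}(r) + 1, i) for every r ∈ [1]^{m−1}. -/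
namespace CubeBlowup

/-- The poset `[1]^m = {0,1}^m`; the coordinate `r_{i+1}` of the paper is `r i`. -/
abbrev Cube (m : ℕ) := Fin m → Fin 2

/-- The cubical blow-up map `α_m : [1]^m → [m]`, `α(r) = max { i : r_i = 1 }`
(with value `0` if all coordinates vanish). -/
def alpha (m : ℕ) (r : Cube m) : Fin (m + 1) :=
  ⟨Finset.univ.sup (fun i : Fin m => if r i = 1 then i.1 + 1 else 0), by
    apply Nat.lt_succ_of_le
    apply Finset.sup_le
    intro i _
    have := i.2
    split <;> omega⟩

/-- The map `δ_{i|v} : [1]^{m} → [1]^{m+1}` inserting the constant `v` as the `i`-th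
coordinate (`1 ≤ i ≤ m+1`). -/
def insertCoord (m i : ℕ) (h1 : 1 ≤ i) (h2 : i ≤ m + 1) (v : Fin 2) (r : Cube m) :
    Cube (m + 1) := fun j =>
  if hj : j.1 + 1 < i then r ⟨j.1, by have := j.2; omega⟩
  else if hj' : j.1 + 1 = i then v
  else r ⟨j.1 - 1, by have := j.2; omega⟩

/-- The coface `δ_i : [m] → [m+1]`, the order-preserving injection omitting `i`. -/
def coface (m i : ℕ) (j : Fin (m + 1)) : Fin (m + 2) :=
  if j.1 < i then ⟨j.1, by have := j.2; omega⟩ else ⟨j.1 + 1, by have := j.2; omega⟩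

/-- The codegeneracy `υ_i : [m+1] → [m]`, the order-preserving surjection with
`υ_i(i) = υ_i(i+1) = i`. -/
def codegen (m i : ℕ) (h : i ≤ m) (j : Fin (m + 2)) : Fin (m + 1) :=
  if hj : j.1 ≤ i then ⟨j.1, by omega⟩ else ⟨j.1 - 1, by have := j.2; omega⟩

/-- The cubical degeneracy `ε_i : [1]^{m+1} → [1]^m` (`0 ≤ i ≤ m`): `ε_0` drops the
first coordinate, and for `i ≥ 1`, `ε_i` replaces the coordinates `r_i, r_{i+1}` by
`max {r_i, r_{i+1}}`. -/
def cubeDegen (m i : ℕ) (h : i ≤ m) (r : Cube (m + 1)) : Cube m := fun j =>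
  if i = 0 then r ⟨j.1 + 1, by have := j.2; omega⟩
  else if j.1 + 1 < i then r ⟨j.1, by have := j.2; omega⟩
  else if j.1 + 1 = i then max (r ⟨i - 1, by omega⟩) (r ⟨i, by omega⟩)
  else r ⟨j.1 + 1, by have := j.2; omega⟩

end CubeBlowup

namespace CubeBlowup

theorem alpha_le_iff {m : ℕ} (r : Cube m) (n : ℕ) :
    (alpha m r).1 ≤ n ↔ ∀ j : Fin m, r j = 1 → j.1 + 1 ≤ n := by
  simp only [alpha, Finset.sup_le_iff, Finset.mem_univ, true_implies]
  refine forall_congr' fun j => ?_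
  split <;> simp_all

/-- For `m ≥ 1` and `1 ≤ i ≤ m` (written here with `m` replaced by
`m + 1`, so `1 ≤ i ≤ m + 1`), the order-preserving maps `[1]^m → [m+1]` given by
`α_{m+1} ∘ δ_{i|1}` and `δ_0^i ∘ υ_0^{i-1} ∘ α_m` coincide; equivalently,
`α_{m+1}(δ_{i|1}(r)) = max (α_m(r) + 1) i` for every `r ∈ [1]^m`. -/
theorem statement_16 (m i : ℕ) (h1 : 1 ≤ i) (h2 : i ≤ m + 1) (r : Cube m) :
    alpha (m + 1) (insertCoord m i h1 h2 1 r)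
      = ⟨max ((alpha m r).1 + 1) i, by have := (alpha m r).2; omega⟩ := by
  refine Fin.ext (eq_of_forall_ge_iff fun n => ?_)
  rw [alpha_le_iff]
  constructor
  · intro h
    have hi : i ≤ n := by
      have := h ⟨i - 1, by omega⟩ (by simp [insertCoord, Nat.sub_add_cancel h1])
      simp only at this
      omega
    have ha : (alpha m r).1 ≤ n - 1 := by
      refine (alpha_le_iff r _).2 fun j hj => ?_
      by_cases hlt : j.1 + 1 < i
      · omega
      · have := h j.succ (by
          simp only [insertCoord, Fin.val_succ]
          rw [dif_neg (by omega), dif_neg (by omega)]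
          simpa using hj)
        simp only [Fin.val_succ] at this
        omega
    simp only
    omega
  · intro h j hj
    have hr := (alpha_le_iff r _).1 le_rfl
    simp only at h
    by_cases hle : j.1 + 1 ≤ i
    · omega
    · simp only [insertCoord] at hj
      rw [dif_neg (by omega), dif_neg (by omega)] at hj
      have := hr _ hj
      simp only at this
      omega

end CubeBlowup
end

section
/- Let R be a commutative ring and K a simplicial R-module. For every simplicial map T: Δⁿ × Iᵐ → K (into the underlying simplicial set of K), the following identity holds in the R-module K_{n+m−1}: Σ_{k=0}^{n+m} (−1)^k d_k( Σ_{π∈𝔖^{n,m}} sgn(π)·T(σ_π) ) = Σ_{j=0}^{n} (−1)^j Σ_{π∈𝔖^{n−1,m}} sgn(π)·T((δ_j × id)∘σ_π) + (−1)^n Σ_{i=1}^{m} (−1)^i Σ_{π∈𝔖^{n,m−1}} sgn(π)·( T((id × δ_{i|0})∘σ_π) − T((id × δ_{i|1})∘σ_π) ), where T(σ) ∈ K_{n+m} denotes the (n+m)-simplex of K obtained by evaluating T on the maximal simplex σ. -/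
noncomputable section

namespace EilenbergZilber

/-- The poset `[1]^m = {0,1}^m`; the coordinate `r_{i+1}` of the paper is `r i`. -/
abbrev Cube (m : ℕ) := Fin m → Fin 2

/-- A simplicial module over `R`: a contravariant functor from the simplex category
(presented by order-preserving maps between the `Fin (q+1)`) to `R`-modules. -/
structure SimplicialModule (R : Type) [CommRing R] where
  obj : ℕ → Type
  [acg : ∀ q, AddCommGroup (obj q)]
  [mod : ∀ q, Module R (obj q)]
  map : ∀ {p q : ℕ}, (Fin (p + 1) →o Fin (q + 1)) → (obj q →ₗ[R] obj p)
  map_id : ∀ q, map (OrderHom.id : Fin (q + 1) →o Fin (q + 1)) = LinearMap.id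
  map_comp : ∀ {p q r : ℕ} (f : Fin (p + 1) →o Fin (q + 1)) (g : Fin (q + 1) →o Fin (r + 1)),
    map (g.comp f) = (map f).comp (map g)

attribute [instance] SimplicialModule.acg SimplicialModule.mod

variable {R : Type} [CommRing R]

/-- A simplicial map `T : Δⁿ × Iᵐ → K` into (the underlying simplicial set of) a
simplicial `R`-module `K`.  Since `Δⁿ × Iᵐ` is the nerve of the poset `[n] × [1]^m`,
its `q`-simplices are the order-preserving maps `[q] → [n] × [1]^m`, so `T` amounts to
a natural family as below. -/
structure PrismMap (K : SimplicialModule R) (n m : ℕ) where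
  T : ∀ q : ℕ, (Fin (q + 1) →o (Fin (n + 1) × Cube m)) → K.obj q
  nat : ∀ (p q : ℕ) (θ : Fin (p + 1) →o Fin (q + 1))
      (f : Fin (q + 1) →o (Fin (n + 1) × Cube m)),
    T p (f.comp θ) = K.map θ (T q f)

/-- `π⁻¹` as a function on natural numbers (extended by the identity out of range). -/
def pinv (N : ℕ) (π : Equiv.Perm (Fin N)) (t : ℕ) : ℕ :=
  if h : t < N then (π.symm ⟨t, h⟩).1 else t

/-- The number of `i < nn` such that `π⁻¹ i < k`. -/
def cnt (N : ℕ) (π : Equiv.Perm (Fin N)) (nn k : ℕ) : ℕ :=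
  ((Finset.range nn).filter (fun i => pinv N π i < k)).card

lemma cnt_le (N : ℕ) (π : Equiv.Perm (Fin N)) (nn k : ℕ) : cnt N π nn k ≤ nn :=
  le_trans (Finset.card_filter_le _ _) (le_of_eq (Finset.card_range nn))

lemma cnt_mono (N : ℕ) (π : Equiv.Perm (Fin N)) (nn : ℕ) {k k' : ℕ} (h : k ≤ k') :
    cnt N π nn k ≤ cnt N π nn k' := by
  apply Finset.card_le_card
  intro x hx
  simp only [Finset.mem_filter] at hx ⊢
  exact ⟨hx.1, lt_of_lt_of_le hx.2 h⟩

lemma ite01_mono {p q : Prop} [Decidable p] [Decidable q] (h : p → q) :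
    (if p then (1 : Fin 2) else 0) ≤ (if q then 1 else 0) := by
  split_ifs with hp hq
  · exact le_refl _
  · exact absurd (h hp) hq
  · decide
  · exact le_refl _

/-- `𝔖^{·,·}`-condition: `π⁻¹` is increasing on the first `nn` positions. -/
def IsShuffle (N nn : ℕ) (π : Equiv.Perm (Fin N)) : Prop :=
  ∀ a b : Fin N, a < b → b.1 < nn → π.symm a < π.symm b

instance (N nn : ℕ) : DecidablePred (IsShuffle N nn) := fun π => by
  unfold IsShuffle; infer_instance

/-- The set `𝔖^{·,·}` of shuffle permutations. -/
def shuffles (N nn : ℕ) : Finset (Equiv.Perm (Fin N)) :=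
  Finset.univ.filter (IsShuffle N nn)

/-- The sign of a permutation, as an integer. -/
def sgnz {N : ℕ} (π : Equiv.Perm (Fin N)) : ℤ := (Equiv.Perm.sign π : ℤ)

/-- The maximal simplex `σ_π : [n+m] → [n] × [1]^m` of `Δⁿ × Iᵐ` associated with a
shuffle `π ∈ 𝔖^{n,m}`: at step `j` the path moves forward in the simplex direction if
`π(j) < n` and in the cube coordinate `π(j) - n` otherwise. -/
def sigmaPath (n m : ℕ) (π : Equiv.Perm (Fin (n + m))) :
    Fin (n + m + 1) →o (Fin (n + 1) × Cube m) where
  toFun k :=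
    (⟨cnt (n + m) π n k.1, Nat.lt_succ_of_le (cnt_le _ _ _ _)⟩,
     fun c => if pinv (n + m) π (n + c.1) < k.1 then 1 else 0)
  monotone' := by
    intro k k' hk
    have hk' : k.1 ≤ k'.1 := hk
    refine ⟨?_, fun c => ite01_mono (fun h => lt_of_lt_of_le h hk')⟩
    simp only [Fin.mk_le_mk]
    exact cnt_mono _ _ _ hk'

/-- The `(n+m-1)`-simplex `(δ_j × id) ∘ σ_π` of `Δⁿ × Iᵐ`, for `π ∈ 𝔖^{n-1,m}`. -/
def facePathJ (n m j : ℕ) (π : Equiv.Perm (Fin (n + m - 1))) :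
    Fin (n + m - 1 + 1) →o (Fin (n + 1) × Cube m) where
  toFun k :=
    (⟨min (if cnt (n + m - 1) π (n - 1) k.1 < j then cnt (n + m - 1) π (n - 1) k.1
          else cnt (n + m - 1) π (n - 1) k.1 + 1) n, by omega⟩,
     fun c => if pinv (n + m - 1) π (n - 1 + c.1) < k.1 then 1 else 0)
  monotone' := by
    intro k k' hk
    have hk' : k.1 ≤ k'.1 := hk
    refine ⟨?_, fun c => ite01_mono (fun h => lt_of_lt_of_le h hk')⟩
    have h1 := cnt_mono (n + m - 1) π (n - 1) hk'
    simp only [Fin.mk_le_mk]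
    split_ifs <;> omega

/-- The `(n+m-1)`-simplex `(id × δ_{i|v}) ∘ σ_π` of `Δⁿ × Iᵐ`, for `π ∈ 𝔖^{n,m-1}`. -/
def facePathI (n m i : ℕ) (v : Fin 2) (π : Equiv.Perm (Fin (n + m - 1))) :
    Fin (n + m - 1 + 1) →o (Fin (n + 1) × Cube m) where
  toFun k :=
    (⟨cnt (n + m - 1) π n k.1, Nat.lt_succ_of_le (cnt_le _ _ _ _)⟩,
     fun c =>
       if c.1 + 1 < i then (if pinv (n + m - 1) π (n + c.1) < k.1 then 1 else 0)
       else if c.1 + 1 = i then v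
       else (if pinv (n + m - 1) π (n + c.1 - 1) < k.1 then 1 else 0))
  monotone' := by
    intro k k' hk
    have hk' : k.1 ≤ k'.1 := hk
    refine ⟨?_, fun c => ?_⟩
    · simp only [Fin.mk_le_mk]
      exact cnt_mono _ _ _ hk'
    · by_cases h1 : c.1 + 1 < i
      · simp only [h1, if_true]
        exact ite01_mono (fun h => lt_of_lt_of_le h hk')
      · by_cases h2 : c.1 + 1 = i
        · simp [h1, h2]
        · simp only [h1, h2, if_false]
          exact ite01_mono (fun h => lt_of_lt_of_le h hk')

/-- The coface `δ_i : [q-1] → [q]` (total, clamped version). -/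
def dfaceHom (q i : ℕ) : Fin (q - 1 + 1) →o Fin (q + 1) where
  toFun j := ⟨if j.1 < i then j.1 else min (j.1 + 1) q, by
    have := j.2; split_ifs <;> omega⟩
  monotone' := by
    intro a b hab
    have h' : a.1 ≤ b.1 := hab
    simp only [Fin.mk_le_mk]
    split_ifs <;> omega



open Equiv

/-- The permutation sending `p` to `v` and acting as `π` on the complements. -/
def insertPerm {N : ℕ} (p v : Fin (N + 1)) (π : Perm (Fin N)) : Perm (Fin (N + 1)) :=
  v.cycleRange⁻¹ * Perm.decomposeFin.symm (0, π) * p.cycleRange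

lemma insertPerm_self {N : ℕ} (p v : Fin (N + 1)) (π : Perm (Fin N)) :
    insertPerm p v π p = v := by
  simp [insertPerm, Fin.cycleRange_self, Perm.inv_def]

lemma insertPerm_succAbove {N : ℕ} (p v : Fin (N + 1)) (π : Perm (Fin N)) (x : Fin N) :
    insertPerm p v π (p.succAbove x) = v.succAbove (π x) := by
  simp [insertPerm, Fin.cycleRange_succAbove, Perm.inv_def]

lemma insertPerm_symm_self {N : ℕ} (p v : Fin (N + 1)) (π : Perm (Fin N)) :
    (insertPerm p v π).symm v = p := by
  rw [Equiv.symm_apply_eq, insertPerm_self]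

lemma insertPerm_symm_succAbove {N : ℕ} (p v : Fin (N + 1)) (π : Perm (Fin N)) (x : Fin N) :
    (insertPerm p v π).symm (v.succAbove x) = p.succAbove (π.symm x) := by
  rw [Equiv.symm_apply_eq, insertPerm_succAbove, Equiv.apply_symm_apply]

lemma sgnz_insertPerm {N : ℕ} (p v : Fin (N + 1)) (π : Perm (Fin N)) :
    sgnz (insertPerm p v π) = (-1) ^ (p.1 + v.1) * sgnz π := by
  simp only [sgnz, insertPerm, Perm.sign_mul, Perm.sign_inv, Fin.sign_cycleRange,
    Perm.decomposeFin.symm_sign, if_true, one_mul]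
  push_cast
  ring

lemma insertPerm_bijective {N : ℕ} (p : Fin (N + 1)) :
    Function.Bijective fun x : Fin (N + 1) × Perm (Fin N) => insertPerm p x.1 x.2 := by
  refine (Fintype.bijective_iff_injective_and_card _).2
    ⟨?_, (Fintype.card_congr Perm.decomposeFin).symm⟩
  rintro ⟨v, π⟩ ⟨w, ρ⟩ h
  have hv : v = w := by
    have := congrArg (fun σ : Perm (Fin (N + 1)) => σ p) h
    simpa only [insertPerm_self] using this
  subst hv
  refine Prod.ext rfl (Equiv.ext fun x => ?_)
  have := congrArg (fun σ : Perm (Fin (N + 1)) => σ (p.succAbove x)) h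
  simpa only [insertPerm_succAbove, Fin.succAbove_right_inj] using this

lemma sum_perm_eq_sum_insertPerm {N : ℕ} {A : Type*} [AddCommMonoid A] (p : Fin (N + 1))
    (F : Perm (Fin (N + 1)) → A) :
    ∑ π, F π = ∑ v, ∑ π, F (insertPerm p v π) := by
  rw [← Fintype.sum_prod_type', ← (insertPerm_bijective p).sum_comp]

lemma val_succAbove {N : ℕ} (p : Fin (N + 1)) (x : Fin N) :
    (p.succAbove x).1 = if x.1 < p.1 then x.1 else x.1 + 1 := by
  simp only [Fin.succAbove, Fin.lt_def, Fin.val_castSucc]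
  split_ifs <;> rfl

lemma pinv_val {N : ℕ} (π : Perm (Fin N)) (x : Fin N) : pinv N π x.1 = (π.symm x).1 := by
  simp [pinv]

lemma pinv_insertPerm_self {N : ℕ} (p v : Fin (N + 1)) (π : Perm (Fin N)) :
    pinv (N + 1) (insertPerm p v π) v.1 = p.1 := by
  rw [pinv_val, insertPerm_symm_self]

lemma pinv_insertPerm_of_lt {N : ℕ} (p v : Fin (N + 1)) (π : Perm (Fin N)) {y : ℕ}
    (hy : y < v.1) :
    pinv (N + 1) (insertPerm p v π) y =
      if pinv N π y < p.1 then pinv N π y else pinv N π y + 1 := by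
  have h := pinv_val (insertPerm p v π) (v.succAbove ⟨y, by omega⟩)
  rw [insertPerm_symm_succAbove, val_succAbove, val_succAbove, if_pos hy, ← pinv_val] at h
  exact h

lemma pinv_insertPerm_of_ge {N : ℕ} (p v : Fin (N + 1)) (π : Perm (Fin N)) {y : ℕ}
    (hy : v.1 ≤ y) (hyN : y < N) :
    pinv (N + 1) (insertPerm p v π) (y + 1) =
      if pinv N π y < p.1 then pinv N π y else pinv N π y + 1 := by
  have h := pinv_val (insertPerm p v π) (v.succAbove ⟨y, hyN⟩)
  rw [insertPerm_symm_succAbove, val_succAbove, val_succAbove, if_neg (not_lt.2 hy),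
    ← pinv_val] at h
  exact h

lemma isShuffle_insertPerm_of_le {N n : ℕ} (p v : Fin (N + 1)) (π : Perm (Fin N))
    (hv : n ≤ v.1) : IsShuffle (N + 1) n (insertPerm p v π) ↔ IsShuffle N n π := by
  constructor
  · intro h a b hab hb
    have h' := h (v.succAbove a) (v.succAbove b) (by simpa using hab)
      (by rw [val_succAbove, if_pos (by omega)]; exact hb)
    simpa only [insertPerm_symm_succAbove, Fin.succAbove_lt_succAbove_iff] using h'
  · intro h a b hab hb
    have ha : a.1 < b.1 := hab
    obtain ⟨a, rfl⟩ := Fin.exists_succAbove_eq (show a ≠ v from fun e => by subst e; omega)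
    obtain ⟨b, rfl⟩ := Fin.exists_succAbove_eq (show b ≠ v from fun e => by subst e; omega)
    simp only [insertPerm_symm_succAbove, Fin.succAbove_lt_succAbove_iff] at hab ⊢
    refine h a b hab ?_
    rw [val_succAbove] at hb
    split_ifs at hb <;> omega

lemma isShuffle_insertPerm_of_lt {N n : ℕ} (p v : Fin (N + 1)) (π : Perm (Fin N))
    (hv : v.1 < n) : IsShuffle (N + 1) n (insertPerm p v π) ↔
      IsShuffle N (n - 1) π ∧
        ∀ y : Fin N, y.1 < n - 1 → (y.1 < v.1 ↔ (π.symm y).1 < p.1) := by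
  constructor
  · intro h
    refine ⟨fun a b hab hb => ?_, fun y hy => ?_⟩
    · have h' := h (v.succAbove a) (v.succAbove b) (by simpa using hab)
        (by rw [val_succAbove]; split_ifs <;> omega)
      simpa only [insertPerm_symm_succAbove, Fin.succAbove_lt_succAbove_iff] using h'
    · have h1 := h (v.succAbove y) v
      have h2 := h v (v.succAbove y)
      simp only [insertPerm_symm_succAbove, insertPerm_symm_self, Fin.lt_def,
        val_succAbove] at h1 h2
      by_cases hyv : y.1 < v.1
      · have := h1 (by simp [hyv]) hv
        split_ifs at this <;> omega
      · have := h2 (by simp only [hyv, if_false]; omega) (by simp only [hyv, if_false]; omega)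
        split_ifs at this <;> omega
  · rintro ⟨h, hs⟩ a b hab hb
    rcases eq_or_ne a v with rfl | ha
    · obtain ⟨b, rfl⟩ := Fin.exists_succAbove_eq (show b ≠ a from hab.ne')
      simp only [insertPerm_symm_succAbove, insertPerm_symm_self, Fin.lt_def,
        val_succAbove] at hab hb ⊢
      have := hs b
      split_ifs at * <;> omega
    · obtain ⟨a, rfl⟩ := Fin.exists_succAbove_eq ha
      rcases eq_or_ne b v with rfl | hbv
      · simp only [insertPerm_symm_succAbove, insertPerm_symm_self, Fin.lt_def,
          val_succAbove] at hab hb ⊢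
        have := hs a
        split_ifs at * <;> omega
      · obtain ⟨b, rfl⟩ := Fin.exists_succAbove_eq hbv
        simp only [insertPerm_symm_succAbove, Fin.succAbove_lt_succAbove_iff] at hab ⊢
        refine h a b hab ?_
        have hab' : a.1 < b.1 := hab
        rw [val_succAbove] at hb
        split_ifs at hb <;> omega

lemma le_cnt_iff {N n : ℕ} {π : Perm (Fin N)} (hπ : IsShuffle N n π) (q : Fin N)
    (hq : q.1 < n) (t : ℕ) : q.1 + 1 ≤ cnt N π n t ↔ (π.symm q).1 < t := by
  constructor
  · intro h
    by_contra hlt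
    have hsub : (Finset.range n).filter (fun i => pinv N π i < t) ⊆ Finset.range q.1 := by
      intro x hx
      simp only [Finset.mem_filter, Finset.mem_range] at hx ⊢
      by_contra hxq
      by_cases hxN : x < N
      · have e : pinv N π x = _ := pinv_val π ⟨x, hxN⟩
        rcases Nat.lt_or_ge q.1 x with hx' | hx'
        · have := hπ q ⟨x, hxN⟩ hx' hx.1
          simp only [Fin.lt_def] at this
          omega
        · have : q = ⟨x, hxN⟩ := Fin.ext (by simp only; omega)
          rw [this] at hlt
          omega
      · have e : pinv N π x = x := by simp [pinv, hxN]
        have := (π.symm q).2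
        omega
    have := Finset.card_le_card hsub
    rw [Finset.card_range] at this
    simp only [cnt] at h
    omega
  · intro h
    have hsub : Finset.range (q.1 + 1) ⊆ (Finset.range n).filter (fun i => pinv N π i < t) := by
      intro x hx
      simp only [Finset.mem_filter, Finset.mem_range] at hx ⊢
      refine ⟨by omega, ?_⟩
      have hxN : x < N := by omega
      have e : pinv N π x = _ := pinv_val π ⟨x, hxN⟩
      rcases Nat.lt_or_ge x q.1 with hx' | hx'
      · have := hπ ⟨x, hxN⟩ q hx' hq
        simp only [Fin.lt_def] at this
        omega
      · have : (⟨x, hxN⟩ : Fin N) = q := Fin.ext (by simp only; omega)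
        rw [this] at e
        omega
    have := Finset.card_le_card hsub
    rwa [Finset.card_range] at this

/-- `sigmaPath` for permutations of an arbitrary number `N` of steps. -/
def pathOf (N n m : ℕ) (π : Perm (Fin N)) : Fin (N + 1) →o (Fin (n + 1) × Cube m) where
  toFun k :=
    (⟨cnt N π n k.1, Nat.lt_succ_of_le (cnt_le _ _ _ _)⟩,
     fun c => if pinv N π (n + c.1) < k.1 then 1 else 0)
  monotone' _ _ hk :=
    ⟨cnt_mono _ _ _ hk, fun _ => ite01_mono fun h => lt_of_lt_of_le h hk⟩

/-- `facePathJ` for permutations of an arbitrary number `N` of steps. -/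
def simplexFacePath (N n m j : ℕ) (π : Perm (Fin N)) :
    Fin (N + 1) →o (Fin (n + 1) × Cube m) where
  toFun k :=
    (⟨min (if cnt N π (n - 1) k.1 < j then cnt N π (n - 1) k.1
          else cnt N π (n - 1) k.1 + 1) n, by omega⟩,
     fun c => if pinv N π (n - 1 + c.1) < k.1 then 1 else 0)
  monotone' k k' hk := by
    refine ⟨?_, fun c => ite01_mono fun h => lt_of_lt_of_le h hk⟩
    have h1 := cnt_mono N π (n - 1) (show k.1 ≤ k'.1 from hk)
    simp only [Fin.mk_le_mk]
    split_ifs <;> omega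

/-- `facePathI` for permutations of an arbitrary number `N` of steps. -/
def cubeFacePath (N n m i : ℕ) (v : Fin 2) (π : Perm (Fin N)) :
    Fin (N + 1) →o (Fin (n + 1) × Cube m) where
  toFun k :=
    (⟨cnt N π n k.1, Nat.lt_succ_of_le (cnt_le _ _ _ _)⟩,
     fun c =>
       if c.1 + 1 < i then (if pinv N π (n + c.1) < k.1 then 1 else 0)
       else if c.1 + 1 = i then v
       else (if pinv N π (n + c.1 - 1) < k.1 then 1 else 0))
  monotone' k k' hk := by
    refine ⟨cnt_mono _ _ _ hk, fun c => ?_⟩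
    dsimp only
    split_ifs with h1 h2
    any_goals simp only [le_refl, Fin.zero_le]
    all_goals exact absurd (lt_of_lt_of_le ‹_› (show k.1 ≤ k'.1 from hk)) ‹_›

/-- The coface `Fin (N + 1) →o Fin (N + 2)` omitting `k`. -/
def coface (N k : ℕ) : Fin (N + 1) →o Fin (N + 1 + 1) := dfaceHom (N + 1) k

lemma coface_val (N k : ℕ) (t : Fin (N + 1)) :
    (coface N k t).1 = if t.1 < k then t.1 else t.1 + 1 := by
  have := t.2
  change (if t.1 < k then t.1 else min (t.1 + 1) (N + 1)) = _
  split_ifs <;> omega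

lemma pathOf_fst {N n m : ℕ} (π : Perm (Fin N)) (t : Fin (N + 1)) :
    (pathOf N n m π t).1.1 = cnt N π n t.1 := rfl

lemma pathOf_snd {N n m : ℕ} (π : Perm (Fin N)) (t : Fin (N + 1)) (c : Fin m) :
    (pathOf N n m π t).2 c = if pinv N π (n + c.1) < t.1 then 1 else 0 := rfl

lemma simplexFacePath_fst {N n m j : ℕ} (π : Perm (Fin N)) (t : Fin (N + 1)) :
    (simplexFacePath N n m j π t).1.1 =
      min (if cnt N π (n - 1) t.1 < j then cnt N π (n - 1) t.1
        else cnt N π (n - 1) t.1 + 1) n := rfl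

lemma simplexFacePath_snd {N n m j : ℕ} (π : Perm (Fin N)) (t : Fin (N + 1)) (c : Fin m) :
    (simplexFacePath N n m j π t).2 c =
      if pinv N π (n - 1 + c.1) < t.1 then 1 else 0 := rfl

lemma cubeFacePath_fst {N n m i : ℕ} (v : Fin 2) (π : Perm (Fin N)) (t : Fin (N + 1)) :
    (cubeFacePath N n m i v π t).1.1 = cnt N π n t.1 := rfl

lemma cubeFacePath_snd {N n m i : ℕ} (v : Fin 2) (π : Perm (Fin N)) (t : Fin (N + 1))
    (c : Fin m) :
    (cubeFacePath N n m i v π t).2 c =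
      if c.1 + 1 < i then (if pinv N π (n + c.1) < t.1 then 1 else 0)
      else if c.1 + 1 = i then v
      else (if pinv N π (n + c.1 - 1) < t.1 then 1 else 0) := rfl

lemma sum_range_succ_eq_add_sum_skip (n v : ℕ) (hv : v ≤ n) (g : ℕ → ℕ) :
    ∑ x ∈ Finset.range (n + 1), g x =
      g v + ∑ y ∈ Finset.range n, g (if y < v then y else y + 1) := by
  rw [Finset.sum_range, Fin.sum_univ_succAbove _ ⟨v, by omega⟩, Finset.sum_range]
  simp only [val_succAbove]

lemma cnt_eq_sum (N : ℕ) (π : Perm (Fin N)) (n k : ℕ) :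
    cnt N π n k = ∑ x ∈ Finset.range n, if pinv N π x < k then 1 else 0 := by
  rw [cnt, Finset.card_filter]

lemma path_ext {N n m : ℕ} {f g : Fin (N + 1) →o (Fin (n + 1) × Cube m)}
    (h1 : ∀ t, (f t).1.1 = (g t).1.1) (h2 : ∀ t c, (f t).2 c = (g t).2 c) : f = g :=
  OrderHom.ext _ _ (funext fun t => Prod.ext (Fin.ext (h1 t)) (funext (h2 t)))

lemma skip_lt_iff {p k : ℕ} (hk : k = p ∨ k = p + 1) (y t : ℕ) :
    ((if y < p then y else y + 1) < if t < k then t else t + 1) ↔ y < t := by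
  split_ifs <;> omega

lemma pathOf_insertPerm_comp_of_le {N n m k : ℕ} (h : n + m = N + 1) (p : Fin (N + 1))
    (x : Fin m) (hv : n + x.1 < N + 1) (hk : k = p.1 ∨ k = p.1 + 1) (e : Fin 2)
    (he : ∀ t : Fin (N + 1),
      (if p.1 < (if t.1 < k then t.1 else t.1 + 1) then (1 : Fin 2) else 0) = e)
    (π : Perm (Fin N)) :
    (pathOf (N + 1) n m (insertPerm p ⟨n + x.1, hv⟩ π)).comp (coface N k) =
      cubeFacePath N n m (x.1 + 1) e π := by
  refine path_ext (fun t => ?_) (fun t c => ?_)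
  · simp only [pathOf_fst, cubeFacePath_fst, OrderHom.comp_coe, Function.comp_apply,
      cnt, coface_val]
    congr 1
    refine Finset.filter_congr fun y hy => ?_
    have hy' : y < n := Finset.mem_range.1 hy
    rw [pinv_insertPerm_of_lt _ _ _ (by simp only; omega), skip_lt_iff hk]
  · simp only [pathOf_snd, cubeFacePath_snd, OrderHom.comp_coe, Function.comp_apply,
      coface_val]
    rcases lt_trichotomy c.1 x.1 with hc | hc | hc
    · rw [if_pos (show c.1 + 1 < x.1 + 1 by omega),
        pinv_insertPerm_of_lt _ _ _ (by simp only; omega)]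
      simp only [skip_lt_iff hk]
    · rw [if_neg (show ¬ c.1 + 1 < x.1 + 1 by omega), if_pos (show c.1 + 1 = x.1 + 1 by omega),
        hc]
      have := pinv_insertPerm_self p ⟨n + x.1, hv⟩ π
      simp only at this
      rw [this, he]
    · rw [if_neg (show ¬ c.1 + 1 < x.1 + 1 by omega), if_neg (show ¬ c.1 + 1 = x.1 + 1 by omega),
        show n + c.1 = n + c.1 - 1 + 1 by omega,
        pinv_insertPerm_of_ge _ _ _ (by simp only; omega) (by omega)]
      simp only [skip_lt_iff hk, Nat.add_sub_cancel]

lemma pathOf_insertPerm_comp_of_lt {N n m k j : ℕ} (h : n + m = N + 1) (p v : Fin (N + 1))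
    (hv : v.1 < n) (hk : k = p.1 ∨ k = p.1 + 1) (π : Perm (Fin N))
    (hj : ∀ t : Fin (N + 1),
      p.1 < (if t.1 < k then t.1 else t.1 + 1) ↔ j ≤ cnt N π (n - 1) t.1) :
    (pathOf (N + 1) n m (insertPerm p v π)).comp (coface N k) =
      simplexFacePath N n m j π := by
  obtain ⟨n, rfl⟩ : ∃ l, n = l + 1 := ⟨n - 1, by omega⟩
  refine path_ext (fun t => ?_) (fun t c => ?_)
  · simp only [pathOf_fst, simplexFacePath_fst, OrderHom.comp_coe,
      Function.comp_apply, coface_val]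
    rw [cnt_eq_sum, sum_range_succ_eq_add_sum_skip n v.1 (by omega), pinv_insertPerm_self]
    have hs : ∀ y ∈ Finset.range n,
        (if pinv (N + 1) (insertPerm p v π) (if y < v.1 then y else y + 1) <
          (if t.1 < k then t.1 else t.1 + 1) then 1 else 0) =
        if pinv N π y < t.1 then 1 else 0 := by
      intro y hy
      have hy' : y < n := Finset.mem_range.1 hy
      by_cases hyv : y < v.1
      · rw [if_pos hyv, pinv_insertPerm_of_lt _ _ _ hyv]
        simp only [skip_lt_iff hk]
      · rw [if_neg hyv, pinv_insertPerm_of_ge _ _ _ (not_lt.1 hyv) (by omega)]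
        simp only [skip_lt_iff hk]
    rw [Finset.sum_congr rfl hs, ← cnt_eq_sum]
    have h1 := hj t
    have h2 := cnt_le N π n t.1
    simp only [Nat.add_sub_cancel] at h1 ⊢
    simp only [h1]
    split_ifs <;> omega
  · simp only [pathOf_snd, simplexFacePath_snd, OrderHom.comp_coe,
      Function.comp_apply, coface_val, Nat.add_sub_cancel]
    rw [show n + 1 + c.1 = n + c.1 + 1 by omega,
      pinv_insertPerm_of_ge _ _ _ (by omega) (by omega)]
    simp only [skip_lt_iff hk]

lemma pathOf_mul_swap_comp {N n m : ℕ} (h : n + m = N + 1) (k : Fin N)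
    (π : Perm (Fin (N + 1))) :
    (pathOf (N + 1) n m (π * swap k.castSucc k.succ)).comp (coface N (k.1 + 1)) =
      (pathOf (N + 1) n m π).comp (coface N (k.1 + 1)) := by
  have key : ∀ y < N + 1, ∀ t : ℕ,
      (pinv (N + 1) (π * swap k.castSucc k.succ) y < if t < k.1 + 1 then t else t + 1) ↔
        (pinv (N + 1) π y < if t < k.1 + 1 then t else t + 1) := by
    intro y hy t
    have e1 : pinv (N + 1) _ y = _ := pinv_val (π * swap k.castSucc k.succ) ⟨y, hy⟩
    have e2 : pinv (N + 1) π y = _ := pinv_val π ⟨y, hy⟩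
    have e3 : (π * swap k.castSucc k.succ).symm ⟨y, hy⟩ =
        swap k.castSucc k.succ (π.symm ⟨y, hy⟩) := rfl
    rw [e1, e2, e3]
    generalize π.symm ⟨y, hy⟩ = z
    by_cases h1 : z = k.castSucc
    · subst h1
      rw [swap_apply_left]
      simp only [Fin.val_succ, Fin.val_castSucc]
      split_ifs <;> omega
    · by_cases h2 : z = k.succ
      · subst h2
        rw [swap_apply_right]
        simp only [Fin.val_succ, Fin.val_castSucc]
        split_ifs <;> omega
      · rw [swap_apply_of_ne_of_ne h1 h2]
  refine path_ext (fun t => ?_) (fun t c => ?_)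
  · simp only [pathOf_fst, OrderHom.comp_coe, Function.comp_apply, cnt,
      coface_val]
    congr 1
    refine Finset.filter_congr fun y hy => key y ?_ t.1
    have := Finset.mem_range.1 hy
    omega
  · simp only [pathOf_snd, OrderHom.comp_coe, Function.comp_apply, coface_val]
    simp only [key (n + c.1) (by omega) t.1]

lemma IsShuffle.mul_swap {N n : ℕ} {π : Perm (Fin (N + 1))} (hπ : IsShuffle (N + 1) n π)
    (k : Fin N) (hk : ¬ ((π k.castSucc).1 < n ∧ (π k.succ).1 < n)) :
    IsShuffle (N + 1) n (π * swap k.castSucc k.succ) := by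
  intro a b hab hb
  have h1 := hπ a b hab hb
  change swap k.castSucc k.succ (π.symm a) < swap k.castSucc k.succ (π.symm b)
  have hne : ¬ (π.symm a = k.castSucc ∧ π.symm b = k.succ) := by
    rintro ⟨ha', hb'⟩
    rw [← ha', ← hb', apply_symm_apply, apply_symm_apply] at hk
    have : a.1 < b.1 := hab
    omega
  generalize π.symm a = x at *
  generalize π.symm b = y at *
  simp only [swap_apply_def, Fin.lt_def, Fin.ext_iff] at *
  split_ifs <;> simp only [Fin.val_succ, Fin.val_castSucc] at * <;> omega

lemma sum_swap_eq_zero {N n m : ℕ} {A : Type*} [AddCommGroup A] (h : n + m = N + 1)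
    (f : (Fin (N + 1) →o (Fin (n + 1) × Cube m)) → A) (k : Fin N) :
    ∑ π ∈ (shuffles (N + 1) n).filter
        (fun π => ¬ ((π k.castSucc).1 < n ∧ (π k.succ).1 < n)),
      sgnz π • f ((pathOf (N + 1) n m π).comp (coface N (k.1 + 1))) = 0 := by
  have hne : k.castSucc ≠ k.succ := Fin.castSucc_lt_succ.ne
  refine Finset.sum_involution (fun π _ => π * swap k.castSucc k.succ) ?_ ?_ ?_ ?_
  · intro π _
    rw [pathOf_mul_swap_comp h, ← add_smul]
    simp [sgnz, Perm.sign_swap hne]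
  · intro π _ _ e
    exact hne (swap_eq_one_iff.1 (mul_eq_left.1 e))
  · intro π hπ
    simp only [shuffles, Finset.mem_filter, Finset.mem_univ, true_and] at hπ ⊢
    refine ⟨hπ.1.mul_swap k hπ.2, ?_⟩
    simpa [and_comm] using hπ.2
  · intro π _
    simp [mul_assoc]

lemma IsShuffle.symm_lt_symm_iff {N n : ℕ} {π : Perm (Fin N)} (hπ : IsShuffle N n π)
    {a b : Fin N} (ha : a.1 < n) (hb : b.1 < n) : (π.symm a).1 < (π.symm b).1 ↔ a.1 < b.1 := by
  refine ⟨fun h => ?_, fun h => hπ a b h hb⟩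
  by_contra hab
  rcases Nat.lt_or_ge b.1 a.1 with h' | h'
  · have : (π.symm b).1 < (π.symm a).1 := hπ b a h' ha
    omega
  · have : a = b := Fin.ext (by omega)
    subst this
    omega

lemma isShuffle_insertPerm_zero {N n : ℕ} (v : Fin (N + 1)) (π : Perm (Fin N))
    (hv : v.1 < n) :
    IsShuffle (N + 1) n (insertPerm 0 v π) ↔ v.1 = 0 ∧ IsShuffle N (n - 1) π := by
  rw [isShuffle_insertPerm_of_lt _ _ _ hv, and_comm]
  refine and_congr_left fun _ => ⟨fun h => ?_, fun h y _ => ?_⟩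
  · by_contra hv0
    have := h ⟨0, by omega⟩ (by simp only; omega)
    simp only [Fin.val_zero] at this
    omega
  · simp only [Fin.val_zero]
    omega

lemma isShuffle_insertPerm_last {N n : ℕ} (hn : n ≤ N + 1) (v : Fin (N + 1))
    (π : Perm (Fin N)) (hv : v.1 < n) :
    IsShuffle (N + 1) n (insertPerm (Fin.last N) v π) ↔
      v.1 = n - 1 ∧ IsShuffle N (n - 1) π := by
  rw [isShuffle_insertPerm_of_lt _ _ _ hv, and_comm]
  refine and_congr_left fun _ => ⟨fun h => ?_, fun h y hy => ?_⟩
  · by_contra hv0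
    have h1 := h ⟨n - 2, by omega⟩ (by simp only; omega)
    have h2 := (π.symm ⟨n - 2, by omega⟩).2
    simp only [Fin.val_last] at h1
    omega
  · have := (π.symm y).2
    simp only [Fin.val_last]
    omega

lemma insertPerm_succ_castSucc {N : ℕ} (k : Fin N) (v : Fin (N + 1)) (π : Perm (Fin N)) :
    insertPerm k.succ v π k.castSucc = v.succAbove (π k) := by
  rw [← insertPerm_succAbove k.succ v π k, Fin.succAbove_succ_self]

lemma not_isShuffle_insertPerm_succ_zero {N n : ℕ} (k : Fin N) (π : Perm (Fin N)) :
    ¬ (IsShuffle (N + 1) n (insertPerm k.succ 0 π) ∧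
      (insertPerm k.succ 0 π k.castSucc).1 < n ∧ (insertPerm k.succ 0 π k.succ).1 < n) := by
  rintro ⟨h, h1, h2⟩
  rw [insertPerm_succ_castSucc, Fin.succAbove_zero, Fin.val_succ] at h1
  rw [insertPerm_self] at h2
  rw [isShuffle_insertPerm_of_lt _ _ _ h2] at h
  have := h.2 (π k) (by omega)
  rw [symm_apply_apply] at this
  simp only [Fin.val_zero, Fin.val_succ] at this
  omega

lemma isShuffle_insertPerm_succ_succ {N n : ℕ} (k y : Fin N) (π : Perm (Fin N)) :
    (IsShuffle (N + 1) n (insertPerm k.succ y.succ π) ∧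
      (insertPerm k.succ y.succ π k.castSucc).1 < n ∧
      (insertPerm k.succ y.succ π k.succ).1 < n) ↔
      π.symm y = k ∧ y.1 + 1 < n ∧ IsShuffle N (n - 1) π := by
  rw [insertPerm_succ_castSucc, insertPerm_self]
  constructor
  · rintro ⟨h, h1, h2⟩
    rw [isShuffle_insertPerm_of_lt _ _ _ h2] at h
    rw [Fin.val_succ] at h2
    refine ⟨?_, h2, h.1⟩
    rw [val_succAbove, Fin.val_succ] at h1
    have hk : (π k).1 < n - 1 := by split_ifs at h1 <;> omega
    have e1 := h.2 (π k) hk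
    have e2 := h.2 y (by omega)
    have e3 := h.1.symm_lt_symm_iff hk (show y.1 < n - 1 by omega)
    simp only [symm_apply_apply, Fin.val_succ] at e1 e2 e3
    rw [symm_apply_eq]
    exact Fin.ext (by omega)
  · rintro ⟨rfl, h2, h⟩
    rw [isShuffle_insertPerm_of_lt _ _ _ (by simpa using h2), apply_symm_apply, val_succAbove,
      Fin.val_succ, if_pos (by omega)]
    refine ⟨⟨h, fun z hz => ?_⟩, by omega, h2⟩
    have := h.symm_lt_symm_iff (show y.1 < n - 1 by omega) hz
    rw [Fin.val_succ]
    omega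

lemma sum_fin_eq_sum_add_sum {N n m : ℕ} {A : Type*} [AddCommMonoid A] (h : n + m = N + 1)
    (G : Fin (N + 1) → A) :
    ∑ v, G v = ∑ a : Fin n, G ⟨a.1, by omega⟩ + ∑ x : Fin m, G ⟨n + x.1, by omega⟩ := by
  rw [← (finCongr h).sum_comp, Fin.sum_univ_add]
  rfl

lemma sum_outer_face {N n m : ℕ} {A : Type*} [AddCommGroup A] (h : n + m = N + 1)
    (f : (Fin (N + 1) →o (Fin (n + 1) × Cube m)) → A) (p : Fin (N + 1)) {k a j : ℕ}
    {e : Fin 2} (hk : k = p.1 ∨ k = p.1 + 1) (ha : n ≠ 0 → a < n)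
    (he : ∀ t : Fin (N + 1),
      (if p.1 < (if t.1 < k then t.1 else t.1 + 1) then (1 : Fin 2) else 0) = e)
    (hs : ∀ (v : Fin (N + 1)) (π : Perm (Fin N)), v.1 < n →
      (IsShuffle (N + 1) n (insertPerm p v π) ↔ v.1 = a ∧ IsShuffle N (n - 1) π))
    (hj : n ≠ 0 → ∀ (π : Perm (Fin N)) (t : Fin (N + 1)),
      p.1 < (if t.1 < k then t.1 else t.1 + 1) ↔ j ≤ cnt N π (n - 1) t.1) :
    ∑ π ∈ shuffles (N + 1) n, sgnz π • f ((pathOf (N + 1) n m π).comp (coface N k)) =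
      (if n = 0 then 0 else (-1 : ℤ) ^ (p.1 + a) •
        ∑ π ∈ shuffles N (n - 1), sgnz π • f (simplexFacePath N n m j π)) +
      ∑ x : Fin m, (-1 : ℤ) ^ (p.1 + (n + x.1)) •
        ∑ π ∈ shuffles N n, sgnz π • f (cubeFacePath N n m (x.1 + 1) e π) := by
  rw [shuffles, Finset.sum_filter, sum_perm_eq_sum_insertPerm p, sum_fin_eq_sum_add_sum h]
  congr 1
  · split_ifs with hn
    · subst hn
      rfl
    · rw [Finset.sum_eq_single (⟨a, ha hn⟩ : Fin n)]
      · rw [Finset.smul_sum, shuffles, Finset.sum_filter]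
        refine Finset.sum_congr rfl fun π _ => ?_
        simp only [hs ⟨a, _⟩ π (ha hn), true_and, sgnz_insertPerm]
        rw [pathOf_insertPerm_comp_of_lt h p ⟨a, _⟩ (ha hn) hk π (hj hn π), mul_smul]
      · intro b _ hb
        refine Finset.sum_eq_zero fun π _ => if_neg ?_
        rw [hs _ _ b.2]
        exact fun hh => hb (Fin.ext hh.1)
      · simp
  · refine Finset.sum_congr rfl fun x _ => ?_
    rw [Finset.smul_sum, shuffles, Finset.sum_filter]
    refine Finset.sum_congr rfl fun π _ => ?_
    simp only [isShuffle_insertPerm_of_le p ⟨n + x.1, _⟩ π (Nat.le_add_right _ _),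
      sgnz_insertPerm]
    rw [pathOf_insertPerm_comp_of_le h p x _ hk e he, mul_smul]

lemma sum_inner_face {N n m : ℕ} {A : Type*} [AddCommGroup A] (h : n + m = N + 1)
    (f : (Fin (N + 1) →o (Fin (n + 1) × Cube m)) → A) (k : Fin N) :
    ∑ π ∈ shuffles (N + 1) n,
        sgnz π • f ((pathOf (N + 1) n m π).comp (coface N (k.1 + 1))) =
      ∑ y : Fin N, ∑ π : Perm (Fin N),
        if π.symm y = k ∧ y.1 + 1 < n ∧ IsShuffle N (n - 1) π then
          ((-1 : ℤ) ^ (k.1 + 1 + (y.1 + 1)) * sgnz π) •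
            f (simplexFacePath N n m (y.1 + 1) π)
        else 0 := by
  rw [← Finset.sum_filter_add_sum_filter_not _
    (fun π => (π k.castSucc).1 < n ∧ (π k.succ).1 < n), sum_swap_eq_zero h, add_zero, shuffles,
    Finset.filter_filter, Finset.sum_filter, sum_perm_eq_sum_insertPerm k.succ,
    Fin.sum_univ_succ]
  rw [Finset.sum_eq_zero fun π _ => if_neg (not_isShuffle_insertPerm_succ_zero k π), zero_add]
  refine Finset.sum_congr rfl fun y _ => Finset.sum_congr rfl fun π _ => ?_
  simp only [isShuffle_insertPerm_succ_succ]
  refine if_ctx_congr Iff.rfl (fun hc => ?_) fun _ => rfl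
  obtain ⟨rfl, hy, hπ⟩ := hc
  rw [sgnz_insertPerm, pathOf_insertPerm_comp_of_lt (k := (π.symm y).1 + 1) (j := y.1 + 1) h
    (π.symm y).succ y.succ (by simpa using hy)
    (Or.inl rfl) π]
  · simp only [Fin.val_succ]
  · intro t
    rw [le_cnt_iff hπ y (by omega), Fin.val_succ]
    split_ifs <;> omega

lemma sum_inner_faces {N n m : ℕ} {A : Type*} [AddCommGroup A] (h : n + m = N + 1)
    (f : (Fin (N + 1) →o (Fin (n + 1) × Cube m)) → A) :
    ∑ k ∈ Finset.range N, (-1 : ℤ) ^ (k + 1) • ∑ π ∈ shuffles (N + 1) n,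
        sgnz π • f ((pathOf (N + 1) n m π).comp (coface N (k + 1))) =
      ∑ y ∈ Finset.range (n - 1), (-1 : ℤ) ^ (y + 1) •
        ∑ π ∈ shuffles N (n - 1), sgnz π • f (simplexFacePath N n m (y + 1) π) := by
  have hr : Finset.range (n - 1) = (Finset.range N).filter fun y => y + 1 < n := by
    ext y
    simp only [Finset.mem_range, Finset.mem_filter]
    omega
  rw [hr, Finset.sum_filter, Finset.sum_range, Finset.sum_range]
  simp only [sum_inner_face h, Finset.smul_sum]
  rw [Finset.sum_comm]
  refine Finset.sum_congr rfl fun y _ => ?_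
  rw [Finset.sum_comm]
  simp only [ite_and, smul_ite, smul_zero, Finset.sum_ite_eq, Finset.mem_univ, if_true]
  split_ifs with hy
  · rw [shuffles, Finset.sum_filter]
    refine Finset.sum_congr rfl fun π _ => if_congr Iff.rfl ?_ rfl
    rw [← mul_smul, ← mul_smul, ← mul_assoc, ← pow_add,
      show (π.symm y).1 + 1 + ((π.symm y).1 + 1 + (y.1 + 1)) =
        2 * ((π.symm y).1 + 1) + (y.1 + 1) by ring, pow_add, pow_mul]
    simp
  · simp

/-- The boundary formula for the shuffle-signed sum of the maximal paths. -/
lemma sum_faces_pathOf {N n m : ℕ} {A : Type*} [AddCommGroup A] (h : n + m = N + 1)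
    (f : (Fin (N + 1) →o (Fin (n + 1) × Cube m)) → A) :
    ∑ k ∈ Finset.range (N + 1 + 1), (-1 : ℤ) ^ k • ∑ π ∈ shuffles (N + 1) n,
        sgnz π • f ((pathOf (N + 1) n m π).comp (coface N k)) =
      (if n = 0 then 0 else
        ∑ j ∈ Finset.range (n + 1), (-1 : ℤ) ^ j •
          ∑ π ∈ shuffles N (n - 1), sgnz π • f (simplexFacePath N n m j π))
      + (-1 : ℤ) ^ n • ∑ i ∈ Finset.Icc 1 m, (-1 : ℤ) ^ i •
          ∑ π ∈ shuffles N n, sgnz π •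
            (f (cubeFacePath N n m i 0 π) - f (cubeFacePath N n m i 1 π)) := by
  have hfirst := sum_outer_face h f 0 (k := 0) (a := 0) (j := 0) (e := 1) (by simp)
    (by omega) (fun t => by simp) (fun v π hv => isShuffle_insertPerm_zero v π hv)
    (fun _ π t => by simp)
  have hlast := sum_outer_face h f (Fin.last N) (k := N + 1) (a := n - 1) (j := n) (e := 0)
    (by simp) (by omega)
    (fun t => by
      have := t.2
      rw [if_pos t.2, if_neg (by simp only [Fin.val_last]; omega)])
    (fun v π hv => isShuffle_insertPerm_last (by omega) v π hv)
    (fun hn π t => by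
      have := t.2
      have := cnt_le N π (n - 1) t.1
      rw [if_pos t.2, Fin.val_last]
      omega)
  rw [Finset.sum_range_succ, Finset.sum_range_succ', sum_inner_faces h, hfirst, hlast]
  have hcube : (-1 : ℤ) ^ n • ∑ i ∈ Finset.Icc 1 m, (-1 : ℤ) ^ i •
      ∑ π ∈ shuffles N n, sgnz π •
        (f (cubeFacePath N n m i 0 π) - f (cubeFacePath N n m i 1 π)) =
      (∑ x : Fin m, (-1 : ℤ) ^ (n + x.1) •
        ∑ π ∈ shuffles N n, sgnz π • f (cubeFacePath N n m (x.1 + 1) 1 π)) +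
      (-1 : ℤ) ^ (N + 1) • ∑ x : Fin m, (-1 : ℤ) ^ (N + (n + x.1)) •
        ∑ π ∈ shuffles N n, sgnz π • f (cubeFacePath N n m (x.1 + 1) 0 π) := by
    rw [← Finset.Ico_add_one_right_eq_Icc, Finset.sum_Ico_eq_sum_range, Nat.add_sub_cancel,
      Finset.sum_range, Finset.smul_sum, Finset.smul_sum, ← Finset.sum_add_distrib]
    refine Finset.sum_congr rfl fun x _ => ?_
    simp only [smul_sub, Finset.sum_sub_distrib, add_comm 1 x.1, ← mul_smul, ← pow_add]
    rw [show N + 1 + (N + (n + x.1)) = 2 * N + (n + (x.1 + 1)) by ring, pow_add _ (2 * N),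
      pow_mul, show n + (x.1 + 1) = n + x.1 + 1 by ring, pow_succ _ (n + x.1)]
    simp only [even_two, Even.neg_pow, one_pow, one_mul, mul_neg, mul_one, neg_smul]
    abel
  rw [hcube]
  rcases n with _ | n
  · simp
  · simp only [Nat.add_eq_zero_iff, one_ne_zero, and_false, if_false, Nat.add_sub_cancel,
      Fin.val_zero, Fin.val_last, zero_add, pow_zero, one_smul, smul_add]
    rw [Finset.sum_range_succ _ (n + 1), Finset.sum_range_succ', ← mul_smul, ← pow_add,
      show N + 1 + (N + n) = 2 * N + (n + 1) by ring, pow_add _ (2 * N), pow_mul]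
    simp only [even_two, Even.neg_pow, one_pow, one_mul, pow_zero, one_smul]
    abel

/-- Lemma 17A.7.2 of the paper.  For every simplicial map
`T : Δⁿ × Iᵐ → K` into a simplicial `R`-module `K` (with `n + m ≥ 1`, so that the
boundary lives in `K_{n+m-1}`), the alternating face sum of the shuffle-signed sum of
the maximal simplices `T(σ_π)` decomposes into the boundary contributions of
`∂Δⁿ × Iᵐ` and of `Δⁿ × ∂Iᵐ`.  (For `n = 0` the first boundary sum is empty.) -/
theorem statement_18 (K : SimplicialModule R) (n m : ℕ) (hnm : 1 ≤ n + m)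
    (TT : PrismMap K n m) :
    ∑ k ∈ Finset.range (n + m + 1), ((-1 : ℤ) ^ k) •
      (K.map (dfaceHom (n + m) k)
        (∑ π ∈ shuffles (n + m) n, sgnz π • TT.T (n + m) (sigmaPath n m π)))
    = (if n = 0 then 0 else
        ∑ j ∈ Finset.range (n + 1), ((-1 : ℤ) ^ j) •
          ∑ π ∈ shuffles (n + m - 1) (n - 1), sgnz π • TT.T (n + m - 1) (facePathJ n m j π))
      + ((-1 : ℤ) ^ n) • ∑ i ∈ Finset.Icc 1 m, ((-1 : ℤ) ^ i) •
          ∑ π ∈ shuffles (n + m - 1) n, sgnz π •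
            (TT.T (n + m - 1) (facePathI n m i 0 π)
              - TT.T (n + m - 1) (facePathI n m i 1 π)) := by
  have hT : ∀ k, K.map (dfaceHom (n + m) k)
      (∑ π ∈ shuffles (n + m) n, sgnz π • TT.T (n + m) (sigmaPath n m π)) =
      ∑ π ∈ shuffles (n + m) n,
        sgnz π • TT.T (n + m - 1) ((sigmaPath n m π).comp (dfaceHom (n + m) k)) := by
    intro k
    simp only [map_sum, map_zsmul, TT.nat]
  simp only [hT]
  change ∑ k ∈ Finset.range (n + m + 1), (-1 : ℤ) ^ k • ∑ π ∈ shuffles (n + m) n,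
        sgnz π • TT.T (n + m - 1) ((pathOf (n + m) n m π).comp (dfaceHom (n + m) k)) =
      (if n = 0 then 0 else
        ∑ j ∈ Finset.range (n + 1), (-1 : ℤ) ^ j •
          ∑ π ∈ shuffles (n + m - 1) (n - 1),
            sgnz π • TT.T (n + m - 1) (simplexFacePath (n + m - 1) n m j π))
      + (-1 : ℤ) ^ n • ∑ i ∈ Finset.Icc 1 m, (-1 : ℤ) ^ i •
          ∑ π ∈ shuffles (n + m - 1) n, sgnz π •
            (TT.T (n + m - 1) (cubeFacePath (n + m - 1) n m i 0 π)
              - TT.T (n + m - 1) (cubeFacePath (n + m - 1) n m i 1 π))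
  obtain ⟨N, hN⟩ : ∃ N, n + m = N + 1 := ⟨n + m - 1, by omega⟩
  rw [hN]
  exact sum_faces_pathOf hN (TT.T N)

end EilenbergZilber
end
end
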